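/- LB_Improved is a lower bound: for any window size W ≥ 0, defining the projection A' of A onto the envelope of B by A'_i = 𝕌^B_i if A_i > 𝕌^B_i, A'_i = 𝕃^B_i if A_i < 𝕃^B_i, and A'_i = A_i otherwise, one has LB_Keogh_W(A,B) + LB_Keogh_W(B,A') ≤ DTW²_W(A,B). -/

import Mathlib

noncomputable section

/-- Squared pointwise cost. -/
def delta (x y : ℝ) : ℝ := (x - y) ^ 2

/-- Continuity/monotonicity step of a warping path. -/
def Step (q r : ℕ × ℕ) : Prop :=
  r = (q.1 + 1, q.2) ∨ r = (q.1, q.2 + 1) ∨ r = (q.1 + 1, q.2 + 1)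

/-- A `W`-warping path for series of length `L` (1-based indices). -/
def IsWarpingPath (L W : ℕ) (p : List (ℕ × ℕ)) : Prop :=
  p.head? = some (1, 1) ∧ p.getLast? = some (L, L) ∧ List.Chain' Step p ∧
    ∀ q ∈ p, 1 ≤ q.1 ∧ q.1 ≤ L ∧ 1 ≤ q.2 ∧ q.2 ≤ L ∧ ((q.1 : ℤ) - (q.2 : ℤ)).natAbs ≤ W

/-- Cost of a warping path. -/
def pathCost (A B : ℕ → ℝ) (p : List (ℕ × ℕ)) : ℝ :=
  (p.map (fun q => delta (A q.1) (B q.2))).sum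

/-- `DTW²_W(A,B)`: minimum cost over all `W`-warping paths. -/
def DTW2 (L W : ℕ) (A B : ℕ → ℝ) : ℝ :=
  sInf (pathCost A B '' {p | IsWarpingPath L W p})

/-- Left band `ℒ^W_i`. -/
def leftBand (W i : ℕ) : Finset (ℕ × ℕ) :=
  (Finset.Icc (max 1 (i - W)) i).image (fun j => (j, i)) ∪
    (Finset.Icc (max 1 (i - W)) i).image (fun k => (i, k))

/-- Right band `ℛ^W_i`. -/
def rightBand (L W i : ℕ) : Finset (ℕ × ℕ) :=
  (Finset.Icc i (min L (i + W))).image (fun j => (j, i)) ∪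
    (Finset.Icc i (min L (i + W))).image (fun k => (i, k))

/-- Vertical band `𝒱_i`. -/
def vertBand (L W i : ℕ) : Finset (ℕ × ℕ) :=
  (Finset.Icc (max 1 (i - W)) (min L (i + W))).image (fun j => (i, j))

/-- Minimum of `δ(A_j, B_k)` over a (finite, nonempty) band of pairs `(j,k)`. -/
def bandMin (A B : ℕ → ℝ) (s : Finset (ℕ × ℕ)) : ℝ :=
  sInf ((fun q => delta (A q.1) (B q.2)) '' (s : Set (ℕ × ℕ)))

/-- Upper envelope `𝕌^B_i`. -/
def upperEnv (L W : ℕ) (B : ℕ → ℝ) (i : ℕ) : ℝ :=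
  sSup (B '' Set.Icc (max 1 (i - W)) (min L (i + W)))

/-- Lower envelope `𝕃^B_i`. -/
def lowerEnv (L W : ℕ) (B : ℕ → ℝ) (i : ℕ) : ℝ :=
  sInf (B '' Set.Icc (max 1 (i - W)) (min L (i + W)))

/-- LB_Keogh term `κ_i`. -/
def kappa (L W : ℕ) (A B : ℕ → ℝ) (i : ℕ) : ℝ :=
  if upperEnv L W B i < A i then delta (A i) (upperEnv L W B i)
  else if A i < lowerEnv L W B i then delta (A i) (lowerEnv L W B i)
  else 0
/-- `LB_Keogh_W(X,C)`. -/
def LBKeogh (L W : ℕ) (X C : ℕ → ℝ) : ℝ := ∑ i ∈ Finset.Icc 1 L, kappa L W X C i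

/-- The projection `A'` of `A` onto the envelope of `B`. -/
def proj (L W : ℕ) (A B : ℕ → ℝ) (i : ℕ) : ℝ :=
  if upperEnv L W B i < A i then upperEnv L W B i
  else if A i < lowerEnv L W B i then lowerEnv L W B i
  else A i

/-- The values of a sequence whose steps increase by at most one have no gaps. -/
theorem exists_mem_eq_of_isChain {α : Type*} {R : α → α → Prop} (f : α → ℕ)
    (hR : ∀ x y, R x y → f y ≤ f x + 1) (l : List α) (a b : α) (hl : l.IsChain R)
    (ha : l.head? = some a) (hb : l.getLast? = some b) (i : ℕ) (hai : f a ≤ i) (hib : i ≤ f b) :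
    ∃ x ∈ l, f x = i := by
  induction l generalizing a with
  | nil => simp at ha
  | cons c l ih =>
    obtain rfl : c = a := by simpa using ha
    rcases hai.eq_or_lt with h | h
    · exact ⟨c, by simp, h⟩
    cases l with
    | nil =>
      obtain rfl : c = b := by simpa using hb
      omega
    | cons d l =>
      rw [List.isChain_cons_cons] at hl
      have hcd := hR _ _ hl.1
      obtain ⟨x, hx, hxi⟩ := ih d hl.2 rfl (by simpa using hb) (by omega)
      exact ⟨x, List.mem_cons_of_mem _ hx, hxi⟩

/-- A finite sum of nonnegative terms is at most the sum along any list covering its indices. -/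
theorem finset_sum_le_list_sum {α : Type*} (f : α → ℕ) (g : ℕ → ℝ)
    (hg : ∀ i, 0 ≤ g i) (s : Finset ℕ) (l : List α) (h : ∀ i ∈ s, ∃ x ∈ l, f x = i) :
    ∑ i ∈ s, g i ≤ (l.map fun x => g (f x)).sum := by
  have hmap : (l.map fun x => g (f x)) = (l.map f).map g := by simp
  rw [hmap, Finset.sum_list_map_count]
  calc ∑ i ∈ s, g i ≤ ∑ i ∈ (l.map f).toFinset, g i :=
        Finset.sum_le_sum_of_subset_of_nonneg (fun i hi => by simpa using h i hi)
          (fun i _ _ => hg i)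
    _ ≤ _ := Finset.sum_le_sum fun i hi => by
        rw [List.mem_toFinset, ← List.one_le_count_iff] at hi
        simpa using nsmul_le_nsmul_left (hg i) hi

theorem Step.fst_le {q r : ℕ × ℕ} (h : Step q r) : r.1 ≤ q.1 + 1 := by
  rcases h with rfl | rfl | rfl <;> simp

theorem Step.snd_le {q r : ℕ × ℕ} (h : Step q r) : r.2 ≤ q.2 + 1 := by
  rcases h with rfl | rfl | rfl <;> simp

theorem le_upperEnv {L W : ℕ} (B : ℕ → ℝ) {i j : ℕ}
    (hj : j ∈ Set.Icc (max 1 (i - W)) (min L (i + W))) : B j ≤ upperEnv L W B i :=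
  le_csSup ((Set.finite_Icc _ _).image B).bddAbove ⟨j, hj, rfl⟩

theorem lowerEnv_le {L W : ℕ} (B : ℕ → ℝ) {i j : ℕ}
    (hj : j ∈ Set.Icc (max 1 (i - W)) (min L (i + W))) : lowerEnv L W B i ≤ B j :=
  csInf_le ((Set.finite_Icc _ _).image B).bddBelow ⟨j, hj, rfl⟩

theorem kappa_nonneg (L W : ℕ) (A B : ℕ → ℝ) (i : ℕ) : 0 ≤ kappa L W A B i := by
  unfold kappa delta
  split_ifs <;> positivity

theorem kappa_add_delta_proj_le {L W : ℕ} (A B : ℕ → ℝ) {i j : ℕ}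
    (hj : j ∈ Set.Icc (max 1 (i - W)) (min L (i + W))) :
    kappa L W A B i + delta (proj L W A B i) (B j) ≤ delta (A i) (B j) := by
  have hu := le_upperEnv B hj
  have hl := lowerEnv_le B hj
  unfold kappa proj delta
  split_ifs with h₁ h₂
  · nlinarith [mul_nonneg (sub_nonneg.2 h₁.le) (sub_nonneg.2 hu)]
  · nlinarith [mul_nonneg (sub_nonneg.2 h₂.le) (sub_nonneg.2 hl)]
  · simp

theorem delta_nonneg (x y : ℝ) : 0 ≤ delta x y := sq_nonneg _

theorem delta_comm (x y : ℝ) : delta x y = delta y x := by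
  unfold delta; ring

theorem kappa_le_delta {L W : ℕ} (A B : ℕ → ℝ) {i j : ℕ}
    (hj : j ∈ Set.Icc (max 1 (i - W)) (min L (i + W))) :
    kappa L W A B i ≤ delta (A i) (B j) :=
  (le_add_of_nonneg_right (delta_nonneg _ _)).trans (kappa_add_delta_proj_le A B hj)

/-- The diagonal is a warping path. -/
theorem isWarpingPath_diagonal {L : ℕ} (hL : 1 ≤ L) (W : ℕ) :
    IsWarpingPath L W ((List.range L).map fun k => (k + 1, k + 1)) := by
  obtain ⟨n, rfl⟩ : ∃ n, L = n + 1 := ⟨L - 1, by omega⟩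
  refine ⟨by simp [List.range_succ_eq_map], by simp [List.range_succ], ?_, ?_⟩
  · refine List.isChain_iff_getElem.2 fun i hi => ?_
    simp [Step]
  · simp only [List.mem_map, List.mem_range]
    rintro q ⟨k, hk, rfl⟩
    simp
    omega

theorem lbImproved_le_pathCost {L W : ℕ} (A B : ℕ → ℝ) {p : List (ℕ × ℕ)}
    (hp : IsWarpingPath L W p) :
    LBKeogh L W A B + LBKeogh L W B (proj L W A B) ≤ pathCost A B p := by
  obtain ⟨hhead, hlast, hchain, hmem⟩ := hp
  have hfst := finset_sum_le_list_sum Prod.fst _ (kappa_nonneg L W A B) (Finset.Icc 1 L) p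
    fun i hi => exists_mem_eq_of_isChain Prod.fst (fun _ _ => Step.fst_le) p _ _ hchain
      hhead hlast i (Finset.mem_Icc.1 hi).1 (Finset.mem_Icc.1 hi).2
  have hsnd := finset_sum_le_list_sum Prod.snd _ (kappa_nonneg L W B (proj L W A B))
    (Finset.Icc 1 L) p
    fun i hi => exists_mem_eq_of_isChain Prod.snd (fun _ _ => Step.snd_le) p _ _ hchain
      hhead hlast i (Finset.mem_Icc.1 hi).1 (Finset.mem_Icc.1 hi).2
  refine (add_le_add hfst hsnd).trans ?_
  rw [← List.sum_map_add]
  refine List.sum_le_sum fun q hq => ?_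
  have hq := hmem q hq
  have h₁ : q.2 ∈ Set.Icc (max 1 (q.1 - W)) (min L (q.1 + W)) := by
    rw [Set.mem_Icc]; omega
  have h₂ : q.1 ∈ Set.Icc (max 1 (q.2 - W)) (min L (q.2 + W)) := by
    rw [Set.mem_Icc]; omega
  have hA := kappa_add_delta_proj_le A B h₁
  have hB := kappa_le_delta B (proj L W A B) h₂
  rw [delta_comm] at hB
  linarith

/-- LB_Improved is a lower bound on `DTW²_W(A,B)`. -/
theorem lbImproved_lower_bound (L W : ℕ) (hL : 1 ≤ L) (A B : ℕ → ℝ) :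
    LBKeogh L W A B + LBKeogh L W B (proj L W A B) ≤ DTW2 L W A B := by
  refine le_csInf (Set.Nonempty.image _ ⟨_, isWarpingPath_diagonal hL W⟩) ?_
  rintro _ ⟨p, hp, rfl⟩
  exact lbImproved_le_pathCost A B hp
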